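/- Let n ≥ 1 be an integer and let φ : ℝⁿ → ℝ be a continuously differentiable function such that φ and ‖∇φ‖ are integrable with respect to μ. Then the L¹-Poincaré inequality ∫_{ℝⁿ} |φ(x) − ∫ φ dμ| dμ(x) ≤ (π/2) ∫_{ℝⁿ} ‖∇φ(x)‖ dμ(x) holds. -/

import Mathlib

open MeasureTheory

/-- The standard Gaussian measure on `ℝⁿ`. -/
noncomputable def stdGaussian (n : ℕ) : Measure (EuclideanSpace ℝ (Fin n)) :=
  volume.withDensity fun x =>
    ENNReal.ofReal ((2 * Real.pi) ^ (-(n : ℝ) / 2) * Real.exp (-‖x‖ ^ 2 / 2))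

open ProbabilityTheory (IsGaussian charFun_stdGaussian integral_strongDual_stdGaussian
  variance_dual_stdGaussian variance_eq_sub variance_nonneg)
open scoped RealInnerProductSpace

/-- The Gaussian density on `ℝⁿ` defines Mathlib's standard Gaussian measure. -/
theorem stdGaussian_eq_probabilityTheory_stdGaussian (n : ℕ) :
    stdGaussian n = ProbabilityTheory.stdGaussian (EuclideanSpace ℝ (Fin n)) := by
  have hb : (0 : ℝ) < (1 / 2 : ℂ).re := by norm_num
  have hint : Integrable (fun x : EuclideanSpace ℝ (Fin n) =>
      (2 * Real.pi) ^ (-(n : ℝ) / 2) * Real.exp (-‖x‖ ^ 2 / 2)) := by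
    have h := (GaussianFourier.integrable_cexp_neg_mul_sq_norm_add hb 0
      (0 : EuclideanSpace ℝ (Fin n))).norm
    refine (h.congr (.of_forall fun x => ?_)).const_mul _
    simp only [Complex.norm_exp]
    congr 1
    have : (-(1 / 2 : ℂ) * (‖x‖ : ℂ) ^ 2 + 0 * ((⟪0, x⟫ : ℝ) : ℂ))
      = ((-‖x‖ ^ 2 / 2 : ℝ) : ℂ) := by push_cast; ring
    rw [this, Complex.ofReal_re]
  have : IsFiniteMeasure (stdGaussian n) := isFiniteMeasure_withDensity_ofReal hint.2
  refine Measure.ext_of_charFun (funext fun t => ?_)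
  rw [charFun_stdGaussian, charFun_apply, stdGaussian,
    integral_withDensity_eq_integral_toReal_smul (by fun_prop) (by simp)]
  have h := GaussianFourier.integral_cexp_neg_mul_sq_norm_add hb Complex.I t
  have hpi : (0 : ℝ) < 2 * Real.pi := by positivity
  calc
    _ = ∫ x : EuclideanSpace ℝ (Fin n), (((2 * Real.pi) ^ (-(n : ℝ) / 2) : ℝ) : ℂ) *
          Complex.exp (-(1 / 2) * ‖x‖ ^ 2 + Complex.I * ⟪t, x⟫) := by
      congr 1 with x
      rw [ENNReal.toReal_ofReal (by positivity), Complex.real_smul, Complex.exp_add,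
        real_inner_comm]
      push_cast
      rw [mul_assoc]
      congr 3 <;> ring_nf
    _ = _ := by
      rw [integral_const_mul, h, finrank_euclideanSpace_fin, ← mul_assoc]
      have : ((Real.pi : ℂ) / (1 / 2)) ^ ((n : ℂ) / 2)
          = (((2 * Real.pi) ^ ((n : ℝ) / 2) : ℝ) : ℂ) := by
        rw [Complex.ofReal_cpow hpi.le]
        push_cast
        congr 1
        ring
      rw [this, ← Complex.ofReal_mul, ← Real.rpow_add hpi, Complex.I_sq]
      ring_nf
      simp

section Gaussian

variable {E : Type*} [NormedAddCommGroup E] [InnerProductSpace ℝ E] [FiniteDimensional ℝ E]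
  [MeasurableSpace E] [BorelSpace E]

theorem lintegral_enorm_strongDual_stdGaussian_le (L : StrongDual ℝ E) :
    ∫⁻ y, ‖L y‖ₑ ∂ProbabilityTheory.stdGaussian E ≤ ‖L‖ₑ := by
  have hL : MemLp L 2 (ProbabilityTheory.stdGaussian E) := IsGaussian.memLp_dual _ L 2 (by simp)
  have hvar := variance_dual_stdGaussian L
  have habs := variance_nonneg (fun y => ‖L y‖) (ProbabilityTheory.stdGaussian E)
  rw [variance_eq_sub hL, integral_strongDual_stdGaussian] at hvar
  rw [variance_eq_sub hL.norm] at habs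
  simp only [Pi.pow_apply, Real.norm_eq_abs, sq_abs] at hvar habs
  rw [← ofReal_integral_norm_eq_lintegral_enorm (hL.integrable (by norm_num)), ← ofReal_norm]
  refine ENNReal.ofReal_le_ofReal (abs_le_of_sq_le_sq' ?_ (norm_nonneg L)).2
  simp only [Real.norm_eq_abs]
  linarith

/-- A Gaussian `L¹` estimate for the difference of two independent copies, obtained by
integrating the derivative along rotations. -/
theorem lintegral_enorm_sub_prod_stdGaussian_le {φ : E → ℝ} (hφ : ContDiff ℝ 1 φ) :
    ∫⁻ z, ‖φ z.2 - φ z.1‖ₑ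
        ∂(ProbabilityTheory.stdGaussian E).prod (ProbabilityTheory.stdGaussian E)
      ≤ ENNReal.ofReal (Real.pi / 2) *
        ∫⁻ x, ‖fderiv ℝ φ x‖ₑ ∂ProbabilityTheory.stdGaussian E := by
  set γ := ProbabilityTheory.stdGaussian E
  have hφ' : Continuous (fderiv ℝ φ) := hφ.continuous_fderiv (by simp)
  let G : E × E → ℝ := fun z => fderiv ℝ φ z.1 z.2
  have hG : Continuous G := (hφ'.comp continuous_fst).clm_apply continuous_snd
  let R : ℝ → E × E → E × E := fun θ z => ContinuousLinearMap.rotation θ z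
  have hR : Continuous fun p : (E × E) × ℝ => R p.2 p.1 := by
    simp only [R, ContinuousLinearMap.rotation_apply]
    fun_prop
  have hGR : Continuous fun p : (E × E) × ℝ => G (R p.2 p.1) := hG.comp hR
  have hpoint (z : E × E) : ‖φ z.2 - φ z.1‖ₑ ≤
      ∫⁻ θ in Set.Ioc 0 (Real.pi / 2), ‖G (R θ z)‖ₑ := by
    have hcont : Continuous fun θ => G (R θ z) := by
      have h : Continuous fun θ : ℝ => (z, θ) := by fun_prop
      have hcomp := hGR.comp h
      exact hcomp
    have hderiv (θ : ℝ) : HasDerivAt (fun θ => φ (R θ z).1) (G (R θ z)) θ := by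
      refine ((hφ.differentiable (by simp)) (R θ z).1).hasFDerivAt.comp_hasDerivAt θ ?_
      simp only [R, ContinuousLinearMap.rotation_apply]
      exact ((Real.hasDerivAt_cos θ).smul_const z.1).add ((Real.hasDerivAt_sin θ).smul_const z.2)
    have hftc := intervalIntegral.integral_eq_sub_of_hasDerivAt (a := 0) (b := Real.pi / 2)
      (fun θ _ => hderiv θ) (hcont.intervalIntegrable _ _)
    simp only [R, ContinuousLinearMap.rotation_apply, Real.cos_pi_div_two, Real.sin_pi_div_two,
      Real.cos_zero, Real.sin_zero, zero_smul, one_smul, zero_add, add_zero] at hftc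
    rw [← hftc, intervalIntegral.integral_of_le (by positivity)]
    exact enorm_integral_le_lintegral_enorm _
  have hrot (θ : ℝ) : ∫⁻ z, ‖G (R θ z)‖ₑ ∂γ.prod γ ≤ ∫⁻ x, ‖fderiv ℝ φ x‖ₑ ∂γ := by
    have hmap : (γ.prod γ).map (R θ) = γ.prod γ :=
      IsGaussian.map_rotation_eq_self (by simp [γ]) θ
    rw [← lintegral_map (μ := γ.prod γ) (f := fun z => ‖G z‖ₑ) (g := R θ)
      hG.enorm.measurable (ContinuousLinearMap.rotation θ).continuous.measurable, hmap,
      lintegral_prod _ hG.enorm.aemeasurable]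
    exact lintegral_mono fun x => lintegral_enorm_strongDual_stdGaussian_le _
  calc
    _ ≤ ∫⁻ z, (∫⁻ θ in Set.Ioc 0 (Real.pi / 2), ‖G (R θ z)‖ₑ) ∂γ.prod γ := lintegral_mono hpoint
    _ = ∫⁻ θ in Set.Ioc 0 (Real.pi / 2), ∫⁻ z, ‖G (R θ z)‖ₑ ∂γ.prod γ :=
      lintegral_lintegral_swap hGR.enorm.aemeasurable
    _ ≤ ∫⁻ _ in Set.Ioc 0 (Real.pi / 2), ∫⁻ x, ‖fderiv ℝ φ x‖ₑ ∂γ := lintegral_mono hrot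
    _ = _ := by simp [mul_comm]

end Gaussian

/-- The `L¹`-Poincaré inequality for the Gaussian measure. -/
theorem gaussian_l1_poincare (n : ℕ) (hn : 1 ≤ n)
    (φ : EuclideanSpace ℝ (Fin n) → ℝ) (hφ : ContDiff ℝ 1 φ)
    (hint : Integrable φ (stdGaussian n))
    (hgrad : Integrable (fun x => ‖gradient φ x‖) (stdGaussian n)) :
    ∫ x, |φ x - ∫ y, φ y ∂stdGaussian n| ∂stdGaussian n
      ≤ Real.pi / 2 * ∫ x, ‖gradient φ x‖ ∂stdGaussian n := by
  rw [stdGaussian_eq_probabilityTheory_stdGaussian] at *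
  set γ := ProbabilityTheory.stdGaussian (EuclideanSpace ℝ (Fin n))
  have hnorm (x : EuclideanSpace ℝ (Fin n)) : ‖gradient φ x‖ = ‖fderiv ℝ φ x‖ :=
    LinearIsometryEquiv.norm_map _ _
  simp only [hnorm] at hgrad ⊢
  have hcenter (x : EuclideanSpace ℝ (Fin n)) :
      ‖φ x - ∫ y, φ y ∂γ‖ₑ ≤ ∫⁻ y, ‖φ y - φ x‖ₑ ∂γ := by
    have h : φ x - ∫ y, φ y ∂γ = ∫ y, (φ x - φ y) ∂γ := by
      rw [integral_sub (integrable_const _) hint]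
      simp
    simp_rw [h, enorm_sub_rev (φ _) (φ x)]
    exact enorm_integral_le_lintegral_enorm _
  have hmeas : AEMeasurable (fun z : EuclideanSpace ℝ (Fin n) × EuclideanSpace ℝ (Fin n) =>
      ‖φ z.2 - φ z.1‖ₑ) (γ.prod γ) := by
    have := hφ.continuous
    exact Continuous.aemeasurable (by fun_prop)
  have hmain := lintegral_enorm_sub_prod_stdGaussian_le hφ
  rw [lintegral_prod _ hmeas] at hmain
  have hle := (lintegral_mono hcenter).trans hmain
  have hdiff : Integrable (fun x => φ x - ∫ y, φ y ∂γ) γ := hint.sub (integrable_const _)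
  have hfderiv : Integrable (fun x => fderiv ℝ φ x) γ :=
    (integrable_norm_iff (hφ.continuous_fderiv (by simp)).aestronglyMeasurable).1 hgrad
  rw [← ofReal_integral_norm_eq_lintegral_enorm hdiff,
    ← ofReal_integral_norm_eq_lintegral_enorm hfderiv,
    ← ENNReal.ofReal_mul (by positivity)] at hle
  exact (ENNReal.ofReal_le_ofReal_iff (by positivity)).1 hle
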